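/- arXiv:1306.1810 — 2 statements merged into one kernel-verified Lean document; each statement's English description precedes it below -/
import Mathlib

section
/- Let n ≥ 3 and let v ∈ k^{(n−2)×n} have uniform matroid of rank n−2, i.e. every set of n−2 columns of v is linearly independent. Let v^⊥ ∈ k^{2×n} be any matrix whose rows form a basis of {x ∈ k^n : v·x = 0}, and let I'_v ⊆ k[x_{ij} : 1≤i≤n−2, 1≤j≤n] be the ideal generated by all n×n minors of the 2(n−2)×n matrix whose entry in row (i,m) ∈ {1,…,n−2}×{1,2} and column j is x_{ij}·v^⊥_{mj} (i.e. whose j-th column is x_j ⊗ v^⊥_j). Then I'_v is a prime ideal and I'_v equals the vanishing ideal I(O(v)) of the orbit of v. -/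
open MvPolynomial

noncomputable section

/-- The orbit of `v` under `GL_r(k) × (k^×)^n` acting by `(g,t)·v = g v diag(t)⁻¹`. -/
def matOrbit (k : Type*) [Field k] {r n : ℕ} (v : Matrix (Fin r) (Fin n) k) :
    Set (Matrix (Fin r) (Fin n) k) :=
  {w | ∃ g : (Matrix (Fin r) (Fin r) k)ˣ, ∃ t : Fin n → kˣ,
    w = Matrix.of fun i j => (g.1 * v) i j * ((t j)⁻¹ : kˣ)}

/-- The vanishing ideal of a set of matrices, inside `k[x_ij]`. -/
def vanIdeal (k : Type*) [Field k] {r n : ℕ} (S : Set (Matrix (Fin r) (Fin n) k)) :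
    Ideal (MvPolynomial (Fin r × Fin n) k) where
  carrier := {p | ∀ w ∈ S, eval (fun ij => w ij.1 ij.2) p = 0}
  add_mem' := by
    intro a b ha hb w hw
    simp [map_add, ha w hw, hb w hw]
  zero_mem' := by
    intro w hw; simp
  smul_mem' := by
    intro c p hp w hw
    simp [smul_eq_mul, hp w hw]

/-- The set of `n × n` minors of the `2(n-2) × n` matrix `x ⊙ v^⊥` whose
`(i,m),j` entry is `x_{ij}·v^⊥_{mj}`: rows are selected by an injection
`ρ : Fin n → Fin (n-2) × Fin 2`. -/
def minorSet5 (k : Type*) [Field k] (n : ℕ) (vp : Matrix (Fin 2) (Fin n) k) :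
    Set (MvPolynomial (Fin (n - 2) × Fin n) k) :=
  {p | ∃ ρ : Fin n → Fin (n - 2) × Fin 2, Function.Injective ρ ∧
    p = Matrix.det (Matrix.of fun s j : Fin n =>
      (X ((ρ s).1, j) : MvPolynomial (Fin (n - 2) × Fin n) k) * C (vp (ρ s).2 j))}

open MonomialOrder

section LeadingForms

variable {σ R : Type*} [CommRing R] (mo : MonomialOrder σ)

theorem degree_sum_le_of_forall {ι : Type*} {s : Finset ι} {f : ι → MvPolynomial σ R}
    {d : σ →₀ ℕ} (h : ∀ i ∈ s, mo.degree (f i) ≼[mo] d) : mo.degree (∑ i ∈ s, f i) ≼[mo] d :=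
  mo.degree_sum_le.trans (Finset.sup_le h)

theorem degree_prod_le_of_forall {ι : Type*} {s : Finset ι} {f : ι → MvPolynomial σ R}
    {d : ι → σ →₀ ℕ} (h : ∀ i ∈ s, mo.degree (f i) ≼[mo] d i) :
    mo.degree (∏ i ∈ s, f i) ≼[mo] ∑ i ∈ s, d i := by
  refine mo.degree_prod_le.trans ?_
  simp only [map_sum]
  exact Finset.sum_le_sum h

theorem coeff_prod_of_degree_le {ι : Type*} {s : Finset ι} {f : ι → MvPolynomial σ R}
    {d : ι → σ →₀ ℕ} (h : ∀ i ∈ s, mo.degree (f i) ≼[mo] d i) :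
    coeff (∑ i ∈ s, d i) (∏ i ∈ s, f i) = ∏ i ∈ s, coeff (d i) (f i) := by
  classical
  induction s using Finset.induction_on with
  | empty => simp
  | insert a s has ih =>
    have hs : ∀ i ∈ s, mo.degree (f i) ≼[mo] d i := fun i hi => h i (Finset.mem_insert_of_mem hi)
    rw [Finset.prod_insert has, Finset.sum_insert has, Finset.prod_insert has,
      mo.coeff_mul_of_add_of_degree_le (h a (Finset.mem_insert_self a s))
        (degree_prod_le_of_forall mo hs), ih hs]

theorem degree_zsmul_units_le (u : ℤˣ) (p : MvPolynomial σ R) :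
    mo.degree (u • p) ≼[mo] mo.degree p := by
  rcases Int.units_eq_one_or u with rfl | rfl
  · simp
  · simp [mo.degree_neg]

theorem degree_det_le {ι : Type*} [Fintype ι] [DecidableEq ι] {N : Matrix ι ι (MvPolynomial σ R)}
    {d : ι → σ →₀ ℕ} (h : ∀ i j, mo.degree (N i j) ≼[mo] d j) :
    mo.degree N.det ≼[mo] ∑ j, d j := by
  rw [Matrix.det_apply]
  refine degree_sum_le_of_forall mo fun τ _ => (degree_zsmul_units_le mo _ _).trans ?_
  exact degree_prod_le_of_forall mo fun i _ => h _ i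

theorem coeff_det_of_degree_le {ι : Type*} [Fintype ι] [DecidableEq ι]
    {N : Matrix ι ι (MvPolynomial σ R)} {d : ι → σ →₀ ℕ}
    (h : ∀ i j, mo.degree (N i j) ≼[mo] d j) :
    coeff (∑ j, d j) N.det = (Matrix.of fun i j => coeff (d j) (N i j)).det := by
  rw [Matrix.det_apply, Matrix.det_apply, coeff_sum]
  refine Finset.sum_congr rfl fun τ _ => ?_
  have := coeff_prod_of_degree_le mo (s := Finset.univ) (f := fun i => N (τ i) i) (d := d)
    fun i _ => h _ i
  rcases Int.units_eq_one_or (Equiv.Perm.sign τ) with hs | hs <;> simp [hs, this]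

theorem eq_zero_or_degree_lt {p : MvPolynomial σ R} {d : σ →₀ ℕ} (hp : mo.degree p ≼[mo] d)
    (h0 : coeff d p = 0) : p = 0 ∨ mo.degree p ≺[mo] d := by
  by_cases hz : p = 0
  · exact Or.inl hz
  · refine Or.inr (lt_of_le_of_ne hp fun he => ?_)
    have hd := mo.toSyn.injective he
    exact hz ((mo.coeff_degree_eq_zero_iff).1 (hd ▸ h0))

theorem degree_eq_of_coeff_ne_zero {p : MvPolynomial σ R} {d : σ →₀ ℕ}
    (hp : mo.degree p ≼[mo] d) (h0 : coeff d p ≠ 0) : mo.degree p = d :=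
  mo.toSyn.injective (le_antisymm hp (mo.le_degree (mem_support_iff.2 h0)))

end LeadingForms

theorem exists_between_of_sum {ι : Type*} [Fintype ι] {a b : ι → ℕ} (hab : ∀ i, a i ≤ b i)
    {N : ℕ} (ha : ∑ i, a i ≤ N) (hb : N ≤ ∑ i, b i) :
    ∃ c : ι → ℕ, (∀ i, a i ≤ c i ∧ c i ≤ b i) ∧ ∑ i, c i = N := by
  classical
  induction N, ha using Nat.le_induction with
  | base => exact ⟨a, fun i => ⟨le_rfl, hab i⟩, rfl⟩
  | succ N hN ih =>
    obtain ⟨c, hc, hs⟩ := ih (by omega)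
    obtain ⟨i, hi⟩ : ∃ i, c i < b i := by
      by_contra! hcon
      have := Finset.sum_le_sum fun i (_ : i ∈ Finset.univ) => hcon i
      omega
    refine ⟨c + Pi.single i 1, fun j => ?_, ?_⟩
    · by_cases hj : j = i
      · subst hj
        simpa using ⟨(hc j).1.trans (Nat.le_succ _), hi⟩
      · simpa [hj] using hc j
    · simp [Finset.sum_add_distrib, hs]

section Reduction

variable {k : Type*} [Field k] {r n : ℕ}

theorem exists_truncation (hr : 1 ≤ r) (m : Fin r × Fin n →₀ ℕ)
    (hm : ¬ ∃ idx : Fin n → Fin r, ∑ l, (idx l : ℕ) + 2 ≤ r ∧ ∀ l, (idx l, l) ∈ m.support) :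
    ∃ c : Fin n → Fin r, ∑ l, (c l : ℕ) + 1 = r ∧ ∀ i l, (i, l) ∈ m.support → c l ≤ i := by
  have hp : ∀ l, ∃ t : Fin r, (∀ i, (i, l) ∈ m.support → t ≤ i) ∧
      ((t, l) ∈ m.support ∨ (t : ℕ) + 1 = r) := by
    intro l
    by_cases h : ∃ i, (i, l) ∈ m.support
    · obtain ⟨t, ht, hmin⟩ := (Set.toFinite {i : Fin r | (i, l) ∈ m.support}).exists_minimal h
      refine ⟨t, fun i hi => ?_, Or.inl ht⟩
      rcases le_total t i with h' | h'
      · exact h'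
      · exact hmin hi h'
    · push Not at h
      exact ⟨⟨r - 1, by omega⟩, fun i hi => absurd hi (h i), Or.inr (by simp; omega)⟩
  choose p hp1 hp2 using hp
  have hsum : r - 1 ≤ ∑ l, (p l : ℕ) := by
    by_contra! hlt
    refine hm ⟨p, by omega, fun l => (hp2 l).resolve_right fun h => ?_⟩
    have := Finset.single_le_sum (f := fun l => (p l : ℕ)) (fun _ _ => Nat.zero_le _)
      (Finset.mem_univ l)
    omega
  obtain ⟨c, hc, hs⟩ := exists_between_of_sum (a := fun _ : Fin n => 0)
    (b := fun l => (p l : ℕ)) (fun _ => Nat.zero_le _) (N := r - 1) (by simp) hsum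
  exact ⟨fun l => ⟨c l, (hc l).2.trans_lt (p l).2⟩, by simp [hs]; omega,
    fun i l hi => Fin.le_def.2 ((hc l).2.trans (hp1 l i hi))⟩

theorem ideal_le_of_leading (hr : 1 ≤ r) (mo : MonomialOrder (Fin r × Fin n))
    (hdeg : ∀ a b : Fin r × Fin n →₀ ℕ, a ≼[mo] b → a.degree ≤ b.degree)
    (J Q : Ideal (MvPolynomial (Fin r × Fin n) k)) (hJQ : J ≤ Q)
    (hlead : ∀ idx : Fin n → Fin r, ∑ l, (idx l : ℕ) + 2 ≤ r → ∃ h ∈ J,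
      mo.degree h ≼[mo] (∑ l, Finsupp.single (idx l, l) 1) ∧
        coeff (∑ l, Finsupp.single (idx l, l) 1) h = 1)
    (hpt : ∀ c : Fin n → Fin r, ∑ l, (c l : ℕ) + 1 = r →
      ∃ (lam : Fin n → MvPolynomial (Fin r × Fin n) k)
        (z : Fin r × Fin n → MvPolynomial (Fin r × Fin n) k) (D : Fin n → Fin r × Fin n →₀ ℕ),
        (∀ i j, c j ≤ i → z (i, j) = lam j * X (i, j)) ∧
        (∀ j, mo.degree (lam j) ≼[mo] D j) ∧ (∀ j, coeff (D j) (lam j) ≠ 0) ∧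
        (∀ i j, mo.degree (z (i, j)) ≼[mo] (D j + Finsupp.single (i, j) 1)) ∧
        ∀ F ∈ Q, aeval (fun u => z u * ∏ l ∈ Finset.univ.erase u.2, lam l) F = 0) :
    Q ≤ J := by
  classical
  suffices H : ∀ (s : mo.syn) (F : MvPolynomial (Fin r × Fin n) k),
      mo.toSyn (mo.degree F) = s → F ∈ Q → F ∈ J from fun F hF => H _ F rfl hF
  intro s
  induction s using WellFoundedLT.induction with
  | ind s ih =>
  intro F hs hF
  subst hs
  by_cases hF0 : F = 0
  · rw [hF0]; exact J.zero_mem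
  set m := mo.degree F with hm
  by_cases hstd : ∃ idx : Fin n → Fin r, ∑ l, (idx l : ℕ) + 2 ≤ r ∧ ∀ l, (idx l, l) ∈ m.support
  · obtain ⟨idx, hidx, hsup⟩ := hstd
    obtain ⟨h, hhJ, hhd, hhc⟩ := hlead idx hidx
    set D : Fin r × Fin n →₀ ℕ := ∑ l, Finsupp.single (idx l, l) 1 with hD
    have hDm : D ≤ m := by
      rintro ⟨i, j⟩
      have : D (i, j) = if idx j = i then 1 else 0 := by
        rw [hD, Finsupp.finsetSum_apply, Finset.sum_eq_single j]
        · simp [Finsupp.single_apply]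
        · intro l _ hl
          simp [hl]
        · simp
      rw [this]
      split_ifs with hi
      · have := hsup j
        rw [hi, Finsupp.mem_support_iff] at this
        omega
      · exact Nat.zero_le _
    have hmd : m - D + D = m := tsub_add_cancel_of_le hDm
    have hmul : mo.degree (monomial (m - D) (coeff m F) * h) ≼[mo] m := by
      refine mo.degree_mul_le.trans ?_
      conv_rhs => rw [← hmd]
      rw [map_add, map_add]
      exact add_le_add (mo.degree_monomial_le _) hhd
    have hcoef : coeff m (monomial (m - D) (coeff m F) * h) = coeff m F := by
      have := mo.coeff_mul_of_add_of_degree_le (mo.degree_monomial_le (d := m - D) (coeff m F)) hhd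
      rw [hmd] at this
      rw [this, hhc]
      simp
    have hmem : monomial (m - D) (coeff m F) * h ∈ J := J.mul_mem_left _ hhJ
    have hG : F - monomial (m - D) (coeff m F) * h ∈ J := by
      rcases eq_zero_or_degree_lt mo (p := F - monomial (m - D) (coeff m F) * h) (d := m)
        (mo.degree_sub_le.trans (max_le le_rfl hmul)) (by simp [hcoef]) with h0 | hlt
      · rw [h0]; exact J.zero_mem
      · exact ih _ hlt _ rfl (Q.sub_mem hF (hJQ hmem))
    simpa using J.add_mem hG hmem
  · exfalso
    obtain ⟨c, hc, hgood⟩ := exists_truncation hr m hstd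
    obtain ⟨lam, z, D, hz, hlamd, hlamc, hzd, hQ⟩ := hpt c hc
    have h0 := hQ F hF
    set Y : Fin r × Fin n → MvPolynomial (Fin r × Fin n) k :=
      fun u => z u * ∏ l ∈ Finset.univ.erase u.2, lam l with hY
    set E : Fin r × Fin n →₀ ℕ := ∑ l, D l with hE
    have hYd : ∀ u, mo.degree (Y u) ≼[mo] (E + Finsupp.single u 1) := by
      rintro ⟨i, j⟩
      have hEj : E + Finsupp.single (i, j) 1 =
          (D j + Finsupp.single (i, j) 1) + ∑ l ∈ Finset.univ.erase j, D l := by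
        rw [hE, ← Finset.add_sum_erase _ _ (Finset.mem_univ j)]
        abel
      rw [hEj]
      refine mo.degree_mul_le.trans ?_
      rw [map_add, map_add mo.toSyn (_ + _)]
      exact add_le_add (hzd i j) (degree_prod_le_of_forall mo fun l _ => hlamd l)
    have hYc : ∀ u ∈ m.support, coeff (E + Finsupp.single u 1) (Y u) ≠ 0 := by
      rintro ⟨i, j⟩ hu
      have hYe : Y (i, j) = (∏ l, lam l) * X (i, j) := by
        rw [hY, ← Finset.mul_prod_erase _ _ (Finset.mem_univ j)]
        simp only [hz i j (hgood i j hu)]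
        ring
      rw [hYe, mo.coeff_mul_of_add_of_degree_le
        (degree_prod_le_of_forall mo fun l _ => hlamd l) mo.degree_X_le_single,
        coeff_prod_of_degree_le mo fun l _ => hlamd l]
      simpa [Finset.prod_ne_zero_iff] using hlamc
    have hpow : ∀ (b : Fin r × Fin n →₀ ℕ) (u), mo.degree (Y u ^ b u) ≼[mo]
        (b u • (E + Finsupp.single u 1)) := by
      intro b u
      refine (mo.degree_pow_le _).trans ?_
      rw [map_nsmul, map_nsmul]
      exact nsmul_le_nsmul_right (hYd u) _
    have hexp : ∀ b : Fin r × Fin n →₀ ℕ,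
        ∑ u, b u • (E + Finsupp.single u 1) = b.degree • E + b := by
      intro b
      have hb : ∑ u, Finsupp.single u (b u) = b := by
        conv_rhs => rw [← Finsupp.sum_single b, Finsupp.sum_fintype _ _ (by simp)]
      simp only [smul_add, Finset.sum_add_distrib, ← Finset.sum_smul, Finsupp.smul_single,
        smul_eq_mul, mul_one, hb, Finsupp.degree_eq_sum]
    have hcoeff : coeff (m.degree • E + m) (aeval Y F) =
        coeff m F * ∏ u, coeff (m u • (E + Finsupp.single u 1)) (Y u ^ m u) := by
      rw [aeval_def, eval₂_eq', coeff_sum, Finset.sum_eq_single m]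
      · rw [algebraMap_eq, coeff_C_mul, ← hexp, coeff_prod_of_degree_le mo fun u _ => hpow m u]
      · intro b hb hbm
        rw [algebraMap_eq, coeff_C_mul]
        have hlt : b ≺[mo] m := lt_of_le_of_ne (mo.le_degree hb) (mo.toSyn.injective.ne hbm)
        have hdl := hdeg b m hlt.le
        refine mul_eq_zero_of_right _ (mo.coeff_eq_zero_of_lt ?_)
        refine (degree_prod_le_of_forall mo fun u _ => hpow b u).trans_lt ?_
        rw [hexp, map_add, map_add, map_nsmul, map_nsmul]
        exact add_lt_add_of_le_of_lt (nsmul_le_nsmul_left (mo.zero_le _) hdl) hlt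
      · intro hmn
        rw [notMem_support_iff.1 hmn]
        simp
    rw [h0, coeff_zero] at hcoeff
    refine mul_ne_zero ((mo.coeff_degree_ne_zero_iff).2 hF0) ?_ hcoeff.symm
    refine Finset.prod_ne_zero_iff.2 fun u _ => ?_
    by_cases hu : u ∈ m.support
    · have := hYc u hu
      have hd := degree_eq_of_coeff_ne_zero mo (hYd u) this
      rw [← hd, mo.coeff_pow_nsmul_degree]
      rw [← hd] at this
      exact pow_ne_zero _ this
    · rw [Finsupp.notMem_support_iff.1 hu]
      simp

end Reduction

section GenericFrames

variable {k : Type*} [Field k] {r n : ℕ}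

/-- The coordinates of the linear functional on `k^r ⊗ k^2` given by the `u.1`-th row of the
frame `c u.2` on the first factor and by the `u.2`-th column of `vp` on the second factor. -/
def frameFunctional (c : Fin n → Matrix (Fin r) (Fin r) k) (vp : Matrix (Fin 2) (Fin n) k)
    (u : Fin r × Fin n) (am : Fin r × Fin 2) : k :=
  c u.2 u.1 am.1 * vp am.2 u.2

/-- A family of frames of `k^r`, one for each column, is generic with respect to `vp` if initial
segments of the functionals of total length `2r` have no common zero. -/
def IsGenericFrame (c : Fin n → Matrix (Fin r) (Fin r) k) (vp : Matrix (Fin 2) (Fin n) k) :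
    Prop :=
  ∀ e : Fin n → ℕ, (∀ l, e l ≤ r) → ∑ l, e l = 2 * r → ∀ κ : Fin r × Fin 2 → k,
    (∀ u : Fin r × Fin n, (u.1 : ℕ) < e u.2 → ∑ am, frameFunctional c vp u am * κ am = 0) → κ = 0

/-- The cells below a staircase, listed column by column. -/
def stairEquiv {e : Fin n → ℕ} (he : ∀ l, e l ≤ r) :
    ((l : Fin n) × Fin (e l)) ≃ {u : Fin r × Fin n // (u.1 : ℕ) < e u.2} where
  toFun s := ⟨(s.2.castLE (he s.1), s.1), s.2.2⟩
  invFun u := ⟨u.1.2, ⟨u.1.1, u.2⟩⟩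
  left_inv _ := rfl
  right_inv _ := rfl

theorem card_stair {e : Fin n → ℕ} (he : ∀ l, e l ≤ r) :
    Fintype.card {u : Fin r × Fin n // (u.1 : ℕ) < e u.2} = ∑ l, e l := by
  rw [← Fintype.card_congr (stairEquiv he)]
  simp

theorem exists_frame_of_staircase {vp : Matrix (Fin 2) (Fin n) k}
    (hpair : ∀ l l', l ≠ l' → vp 0 l * vp 1 l' - vp 1 l * vp 0 l' ≠ 0)
    {e : Fin n → ℕ} (he : ∀ l, e l ≤ r) (hs : ∑ l, e l = 2 * r) :
    ∃ c : Fin n → Matrix (Fin r) (Fin r) k, ∀ κ : Fin r × Fin 2 → k,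
      (∀ u : Fin r × Fin n, (u.1 : ℕ) < e u.2 → ∑ am, frameFunctional c vp u am * κ am = 0) →
        κ = 0 := by
  classical
  refine ⟨fun l => Matrix.of fun i a =>
    if h : (i : ℕ) < e l then
      if (finSigmaFinEquiv (n := e) ⟨l, ⟨i, h⟩⟩ : ℕ) % r = a then 1 else 0 else 0,
    fun κ hκ => ?_⟩
  have key : ∀ (s : (l : Fin n) × Fin (e l)) (a : Fin r), (finSigmaFinEquiv s : ℕ) % r = a →
      vp 0 s.1 * κ (a, 0) + vp 1 s.1 * κ (a, 1) = 0 := by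
    intro s a hsa
    have h := hκ (stairEquiv he s).1 (stairEquiv he s).2
    have h2 : ((stairEquiv he s).1.1 : ℕ) < e (stairEquiv he s).1.2 := (stairEquiv he s).2
    have h3 : (⟨(stairEquiv he s).1.2, ⟨(stairEquiv he s).1.1, h2⟩⟩ : (l : Fin n) × Fin (e l)) = s :=
      rfl
    simp only [frameFunctional, Matrix.of_apply, h2, dif_pos, h3, hsa, Fintype.sum_prod_type,
      Fin.sum_univ_two] at h
    rw [Finset.sum_eq_single a] at h
    · simpa [stairEquiv] using h
    · intro b _ hb
      simp [Fin.val_inj, Ne.symm hb]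
    · simp
  ext ⟨a, m⟩
  have hval : ∀ s : (l : Fin n) × Fin (e l), ((finSigmaFinEquiv s : Fin (∑ l, e l)) : ℕ) =
      ∑ j : Fin s.1, e (Fin.castLE s.1.2.le j) + s.2 := fun s => finSigmaFinEquiv_apply s
  obtain ⟨s, hsv⟩ : ∃ s, (finSigmaFinEquiv (n := e) s : ℕ) = a :=
    ⟨finSigmaFinEquiv.symm ⟨a, by omega⟩, by simp⟩
  obtain ⟨t, htv⟩ : ∃ t, (finSigmaFinEquiv (n := e) t : ℕ) = a + r :=
    ⟨finSigmaFinEquiv.symm ⟨a + r, by omega⟩, by simp⟩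
  have hne : s.1 ≠ t.1 := by
    obtain ⟨l, i⟩ := s
    obtain ⟨l', i'⟩ := t
    rintro rfl
    rw [hval] at hsv htv
    have := (show (i' : ℕ) < e l from i'.2).trans_le (he l)
    dsimp only at hsv htv
    omega
  have h1 := key s a (by rw [hsv, Nat.mod_eq_of_lt a.2])
  have h2 := key t a (by rw [htv, Nat.add_mod_right, Nat.mod_eq_of_lt a.2])
  have hd := hpair _ _ hne
  have e0 : κ (a, 0) = 0 := by
    refine (mul_eq_zero.1 ?_).resolve_left hd
    linear_combination vp 1 t.1 * h1 - vp 1 s.1 * h2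
  have e1 : κ (a, 1) = 0 := by
    refine (mul_eq_zero.1 ?_).resolve_left hd
    linear_combination vp 0 s.1 * h2 - vp 0 t.1 * h1
  fin_cases m
  · exact e0
  · exact e1

theorem exists_common_eval_ne_zero [Infinite k] {σ ι : Type*} [Finite ι]
    (p : ι → MvPolynomial σ k) (h : ∀ i, ∃ x, eval x (p i) ≠ 0) :
    ∃ x, ∀ i, eval x (p i) ≠ 0 := by
  have := Fintype.ofFinite ι
  have hp : ∏ i, p i ≠ 0 := Finset.prod_ne_zero_iff.2 fun i _ h0 => by
    obtain ⟨x, hx⟩ := h i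
    exact hx (by rw [h0, map_zero])
  by_contra! hcon
  refine hp (MvPolynomial.funext fun x => ?_)
  obtain ⟨i, hi⟩ := hcon x
  rw [map_prod, map_zero, Finset.prod_eq_zero (Finset.mem_univ i) hi]

theorem exists_isGenericFrame [Infinite k] {vp : Matrix (Fin 2) (Fin n) k}
    (hpair : ∀ l l', l ≠ l' → vp 0 l * vp 1 l' - vp 1 l * vp 0 l' ≠ 0) :
    ∃ c : Fin n → Matrix (Fin r) (Fin r) k, (∀ l, (c l).det ≠ 0) ∧ IsGenericFrame c vp := by
  classical
  let I := {e : Fin n → Fin (r + 1) // ∑ l, (e l : ℕ) = 2 * r}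
  have hcard : ∀ e : I, Nonempty
      ((Fin r × Fin 2) ≃ {u : Fin r × Fin n // (u.1 : ℕ) < (e.1 u.2 : ℕ)}) := fun e =>
    ⟨Fintype.equivOfCardEq (by
      rw [card_stair (e := fun l => (e.1 l : ℕ)) fun l => Nat.lt_succ_iff.1 (e.1 l).2, e.2]
      simp [mul_comm])⟩
  let ε := fun e => (hcard e).some
  let N : (Fin n × Fin r × Fin r → k) → I → Matrix (Fin r × Fin 2) (Fin r × Fin 2) k :=
    fun x e => Matrix.of fun s am =>
      frameFunctional (fun l => Matrix.of fun i a => x (l, i, a)) vp (ε e s).1 am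
  let p : I ⊕ Fin n → MvPolynomial (Fin n × Fin r × Fin r) k := Sum.elim
    (fun e => Matrix.det (Matrix.of fun s am =>
      X ((ε e s).1.2, (ε e s).1.1, am.1) * C (vp am.2 (ε e s).1.2)))
    (fun l => Matrix.det (Matrix.of fun i a => X (l, i, a)))
  have hpN : ∀ x e, eval x (p (Sum.inl e)) = (N x e).det := by
    intro x e
    simp only [p, Sum.elim_inl, RingHom.map_det]
    congr 1
    ext s am
    simp [N, frameFunctional]
  have hpC : ∀ x l, eval x (p (Sum.inr l)) = Matrix.det (Matrix.of fun i a => x (l, i, a)) := by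
    intro x l
    simp only [p, Sum.elim_inr, RingHom.map_det]
    congr 1
    ext s am
    simp
  obtain ⟨x, hx⟩ := exists_common_eval_ne_zero p (by
    rintro (e | l)
    · obtain ⟨c, hc⟩ := exists_frame_of_staircase (r := r) hpair (e := fun l => (e.1 l : ℕ))
        (fun l => Nat.lt_succ_iff.1 (e.1 l).2) e.2
      refine ⟨fun q => c q.1 q.2.1 q.2.2, ?_⟩
      rw [hpN]
      intro h0
      obtain ⟨κ, hκ, hz⟩ := Matrix.exists_mulVec_eq_zero_iff.2 h0
      refine hκ (hc κ fun u hu => ?_)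
      have := congrFun hz ((ε e).symm ⟨u, hu⟩)
      simpa [N, Matrix.mulVec, dotProduct, frameFunctional] using this
    · refine ⟨fun q => if q.2.1 = q.2.2 then 1 else 0, ?_⟩
      rw [hpC]
      have : (Matrix.of fun i a : Fin r => if i = a then (1 : k) else 0) = 1 := by
        ext i a
        simp [Matrix.one_apply]
      simp [this])
  refine ⟨fun l => Matrix.of fun i a => x (l, i, a), fun l => ?_, fun e he hs κ hκ => ?_⟩
  · rw [← hpC]
    exact hx _
  · let e' : I := ⟨fun l => ⟨e l, Nat.lt_succ_iff.2 (he l)⟩, hs⟩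
    have h0 := hx (Sum.inl e')
    rw [hpN] at h0
    by_contra hne
    refine h0 (Matrix.exists_mulVec_eq_zero_iff.1 ⟨κ, hne, ?_⟩)
    ext s
    exact hκ _ (ε e' s).2

variable {c : Fin n → Matrix (Fin r) (Fin r) k} {vp : Matrix (Fin 2) (Fin n) k}

theorem IsGenericFrame.exists_matrix (hc : IsGenericFrame c vp) {e : Fin n → ℕ}
    (he : ∀ l, e l ≤ r) (hs : ∑ l, e l = 2 * r) :
    ∃ ε : (Fin r × Fin 2) ≃ {u : Fin r × Fin n // (u.1 : ℕ) < e u.2},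
      IsUnit (Matrix.of fun s am => frameFunctional c vp (ε s).1 am) := by
  classical
  let ε : (Fin r × Fin 2) ≃ {u : Fin r × Fin n // (u.1 : ℕ) < e u.2} :=
    Fintype.equivOfCardEq (by rw [card_stair he, hs]; simp [mul_comm])
  refine ⟨ε, (Matrix.isUnit_iff_isUnit_det _).2 (isUnit_iff_ne_zero.2 fun h0 => ?_)⟩
  obtain ⟨κ, hκ, hz⟩ := Matrix.exists_mulVec_eq_zero_iff.2 h0
  refine hκ (hc e he hs κ fun u hu => ?_)
  have := congrFun hz (ε.symm ⟨u, hu⟩)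
  simpa [Matrix.mulVec, dotProduct] using this

theorem IsGenericFrame.exists_solution (hc : IsGenericFrame c vp) {e : Fin n → ℕ}
    (he : ∀ l, e l ≤ r) (hs : ∑ l, e l = 2 * r) (θ : Fin r × Fin n → k) :
    ∃ κ : Fin r × Fin 2 → k, ∀ u : Fin r × Fin n, (u.1 : ℕ) < e u.2 →
      ∑ am, frameFunctional c vp u am * κ am = θ u := by
  obtain ⟨ε, hε⟩ := hc.exists_matrix he hs
  obtain ⟨κ, hκ⟩ := Matrix.mulVec_surjective_iff_isUnit.2 hε fun s => θ (ε s).1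
  refine ⟨κ, fun u hu => ?_⟩
  have := congrFun hκ (ε.symm ⟨u, hu⟩)
  simpa [Matrix.mulVec, dotProduct] using this

theorem IsGenericFrame.eq_zero_of_sum_eq_zero (hc : IsGenericFrame c vp) {e : Fin n → ℕ}
    (he : ∀ l, e l ≤ r) (hs : ∑ l, e l = 2 * r) (τ : Fin r × Fin n → k)
    (hτ : ∀ u, e u.2 ≤ u.1 → τ u = 0)
    (h : ∀ am, ∑ u, τ u * frameFunctional c vp u am = 0) : τ = 0 := by
  obtain ⟨ε, hε⟩ := hc.exists_matrix he hs
  have hz : (fun s => τ (ε s).1) = 0 := by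
    refine Matrix.vecMul_injective_iff_isUnit.2 hε ?_
    ext am
    simp only [Matrix.vecMul, dotProduct, Matrix.of_apply, Pi.zero_apply, zero_mul,
      Finset.sum_const_zero]
    rw [Equiv.sum_comp ε fun u => τ u.1 * frameFunctional c vp u.1 am, ← h am]
    rw [← Finset.sum_subtype (Finset.univ.filter fun u : Fin r × Fin n => (u.1 : ℕ) < e u.2)
      (by simp) fun u => τ u * frameFunctional c vp u am]
    refine Finset.sum_filter_of_ne fun u _ hu => ?_
    by_contra hlt
    exact hu (by rw [hτ u (not_lt.1 hlt), zero_mul])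
  ext u
  by_cases hu : (u.1 : ℕ) < e u.2
  · simpa using congrFun hz (ε.symm ⟨u, hu⟩)
  · exact hτ u (not_lt.1 hu)

end GenericFrames

section LeadingMinors

variable {k : Type*} [Field k] {r n : ℕ}

/-- The maximal minors of the matrix with rows indexed by `Fin r × Fin 2` whose `j`-th column is
`x_j ⊗ vp_j`. -/
def tensorMinors (r : ℕ) (vp : Matrix (Fin 2) (Fin n) k) :
    Set (MvPolynomial (Fin r × Fin n) k) :=
  {p | ∃ ρ : Fin n → Fin r × Fin 2, Function.Injective ρ ∧
    p = Matrix.det (Matrix.of fun s j : Fin n =>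
      (X ((ρ s).1, j) : MvPolynomial (Fin r × Fin n) k) * C (vp (ρ s).2 j))}

theorem det_combination_mem_span_tensorMinors (vp : Matrix (Fin 2) (Fin n) k)
    (κ : Fin n → Fin r × Fin 2 → k) :
    (Matrix.of fun s j : Fin n => ∑ am, C (κ s am) *
      ((X (am.1, j) : MvPolynomial (Fin r × Fin n) k) * C (vp am.2 j))).det ∈
      Ideal.span (tensorMinors r vp) := by
  classical
  have h := (Matrix.detRowAlternating (n := Fin n)
    (R := MvPolynomial (Fin r × Fin n) k)).toMultilinearMap.map_sum
    (fun (s : Fin n) (am : Fin r × Fin 2) => (C (κ s am) : MvPolynomial (Fin r × Fin n) k) •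
      fun j => (X (am.1, j) : MvPolynomial (Fin r × Fin n) k) * C (vp am.2 j))
  have hrow : (Matrix.of fun s j : Fin n => ∑ am, C (κ s am) *
      ((X (am.1, j) : MvPolynomial (Fin r × Fin n) k) * C (vp am.2 j))).det =
      Matrix.detRowAlternating.toMultilinearMap fun s => ∑ am : Fin r × Fin 2,
        (C (κ s am) : MvPolynomial (Fin r × Fin n) k) •
          fun j => (X (am.1, j) : MvPolynomial (Fin r × Fin n) k) * C (vp am.2 j) := by
    change Matrix.det _ = Matrix.det _
    congr 1
    ext1 s j
    simp [Finset.sum_apply]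
  rw [hrow, h]
  refine Ideal.sum_mem _ fun ρ _ => ?_
  rw [MultilinearMap.map_smul_univ, smul_eq_mul]
  refine Ideal.mul_mem_left _ _ ?_
  by_cases hρ : Function.Injective ρ
  · exact Ideal.subset_span ⟨ρ, hρ, rfl⟩
  · obtain ⟨s, s', he, hne⟩ : ∃ s s', ρ s = ρ s' ∧ s ≠ s' := by
      simpa [Function.Injective] using hρ
    have h0 : Matrix.det (Matrix.of fun s j : Fin n =>
        (X ((ρ s).1, j) : MvPolynomial (Fin r × Fin n) k) * C (vp (ρ s).2 j)) = 0 :=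
      Matrix.det_zero_of_row_eq hne (by ext1 j; simp [he])
    have h1 : (Matrix.detRowAlternating (n := Fin n)
        (R := MvPolynomial (Fin r × Fin n) k)).toMultilinearMap (fun s j =>
        (X ((ρ s).1, j) : MvPolynomial (Fin r × Fin n) k) * C (vp (ρ s).2 j)) = 0 := h0
    rw [h1]
    exact Ideal.zero_mem _

/-- The linear change of coordinates given by a frame in each column. -/
def changeFrame (c : Fin n → Matrix (Fin r) (Fin r) k) :
    MvPolynomial (Fin r × Fin n) k →ₐ[k] MvPolynomial (Fin r × Fin n) k :=
  aeval fun u => ∑ i, C (c u.2 i u.1) * X (i, u.2)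

theorem changeFrame_combination (c : Fin n → Matrix (Fin r) (Fin r) k)
    (vp : Matrix (Fin 2) (Fin n) k) (κ : Fin r × Fin 2 → k) (j : Fin n) :
    changeFrame c (∑ am, C (κ am) * (X (am.1, j) * C (vp am.2 j))) =
      ∑ i, C (∑ am, frameFunctional c vp (i, j) am * κ am) * X (i, j) := by
  have hC : ∀ a : k, changeFrame c (C a) = C a := fun a => (changeFrame c).commutes a
  have hX : ∀ u, changeFrame c (X u) = ∑ i, C (c u.2 i u.1) * X (i, u.2) := fun u => aeval_X _ _
  simp only [map_sum, map_mul, hC, hX, Finset.sum_mul, Finset.mul_sum, frameFunctional]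
  rw [Finset.sum_comm]
  exact Finset.sum_congr rfl fun i _ => Finset.sum_congr rfl fun am _ => by ring

theorem exists_leading_minor {c : Fin n → Matrix (Fin r) (Fin r) k}
    {vp : Matrix (Fin 2) (Fin n) k} (hn : n = r + 2) (hc : IsGenericFrame c vp)
    (mo : MonomialOrder (Fin r × Fin n))
    (hmo : ∀ (i i' : Fin r) (j : Fin n), i ≤ i' →
      Finsupp.single (i', j) 1 ≼[mo] Finsupp.single (i, j) 1)
    (idx : Fin n → Fin r) (hidx : ∑ l, (idx l : ℕ) + 2 ≤ r) :
    ∃ h ∈ (Ideal.span (tensorMinors r vp)).map (changeFrame c),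
      mo.degree h ≼[mo] (∑ l, Finsupp.single (idx l, l) 1) ∧
        coeff (∑ l, Finsupp.single (idx l, l) 1) h = 1 := by
  classical
  obtain ⟨e, he, hes⟩ := exists_between_of_sum (a := fun l => (idx l : ℕ) + 1) (b := fun _ => r)
    (fun l => (idx l).2) (N := 2 * r) (by simp [Finset.sum_add_distrib]; omega)
    (by simpa using Nat.mul_le_mul_right r (by omega : 2 ≤ n))
  choose κ hκ using fun s : Fin n => hc.exists_solution (fun l => (he l).2) hes
    fun u => if u.1 = idx u.2 ∧ u.2 = s then 1 else 0
  have hdet : changeFrame c (Matrix.of fun s j : Fin n => ∑ am, C (κ s am) *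
      ((X (am.1, j) : MvPolynomial (Fin r × Fin n) k) * C (vp am.2 j))).det =
      (Matrix.of fun s j : Fin n =>
        ∑ i, C (∑ am, frameFunctional c vp (i, j) am * κ s am) * X (i, j)).det := by
    rw [AlgHom.map_det]
    congr 1
    ext1 s j
    exact changeFrame_combination c vp (κ s) j
  have hent : ∀ s j, mo.degree ((Matrix.of fun s j : Fin n => ∑ i,
      C (∑ am, frameFunctional c vp (i, j) am * κ s am) *
        (X (i, j) : MvPolynomial (Fin r × Fin n) k)) s j) ≼[mo] Finsupp.single (idx j, j) 1 := by
    intro s j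
    rw [Matrix.of_apply]
    refine degree_sum_le_of_forall mo fun i _ => ?_
    rcases lt_or_ge i (idx j) with hi | hi
    · rw [hκ s (i, j) ((Fin.lt_def.1 hi).trans ((Nat.lt_succ_self _).trans_le (he j).1))]
      simp [hi.ne]
    · refine mo.degree_mul_le.trans ?_
      rw [mo.degree_C, zero_add]
      exact mo.degree_X_le_single.trans (hmo _ _ _ hi)
  refine ⟨_, Ideal.mem_map_of_mem _ (det_combination_mem_span_tensorMinors vp κ), ?_, ?_⟩
  · rw [hdet]
    exact degree_det_le mo hent
  · rw [hdet, coeff_det_of_degree_le mo hent]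
    convert Matrix.det_one (n := Fin n) (R := k)
    ext s j
    have hcX : ∀ i, coeff (Finsupp.single (idx j, j) 1)
        (X (i, j) : MvPolynomial (Fin r × Fin n) k) = if i = idx j then 1 else 0 := by
      intro i
      rw [coeff_X]
      simp [Finsupp.single_left_inj]
    simp only [Matrix.of_apply, coeff_sum, coeff_C_mul, hcX, mul_ite, mul_one, mul_zero,
      Finset.sum_ite_eq', Finset.mem_univ, if_true]
    rw [hκ s (idx j, j) (he j).1]
    simp [Matrix.one_apply, eq_comm]

end LeadingMinors

section PolynomialPoint

variable {k : Type*} [Field k] {r n : ℕ}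

theorem exists_linear_relation {c : Fin n → Matrix (Fin r) (Fin r) k}
    {vp : Matrix (Fin 2) (Fin n) k} (hn : n = r + 2) (hc : IsGenericFrame c vp)
    (mo : MonomialOrder (Fin r × Fin n))
    (hmo : ∀ (i i' : Fin r) (j : Fin n), i ≤ i' →
      Finsupp.single (i', j) 1 ≼[mo] Finsupp.single (i, j) 1)
    (p : Fin n → Fin r) (hp : ∑ l, (p l : ℕ) + 1 = r) :
    ∃ (lam : Fin n → MvPolynomial (Fin r × Fin n) k)
      (z : Fin r × Fin n → MvPolynomial (Fin r × Fin n) k) (D : Fin n → Fin r × Fin n →₀ ℕ),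
      (∀ i j, p j ≤ i → z (i, j) = lam j * X (i, j)) ∧
      (∀ j, mo.degree (lam j) ≼[mo] D j) ∧ (∀ j, coeff (D j) (lam j) ≠ 0) ∧
      (∀ i j, mo.degree (z (i, j)) ≼[mo] (D j + Finsupp.single (i, j) 1)) ∧
      ∀ am, ∑ u, z u * C (frameFunctional c vp u am) = 0 := by
  classical
  have hcard := card_stair (e := fun l => (p l : ℕ) + 1) fun l => (p l).2
  let U := {u : Fin r × Fin n // (u.1 : ℕ) < (p u.2 : ℕ) + 1}
  have hUc : Fintype.card U = Fintype.card (Option (Fin r × Fin 2)) := by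
    rw [hcard]
    simp [Finset.sum_add_distrib]
    omega
  let ε : U ≃ Option (Fin r × Fin 2) := Fintype.equivOfCardEq hUc
  let ent : Fin r × Fin n → Fin r × Fin 2 → MvPolynomial (Fin r × Fin n) k := fun u am =>
    if u.1 < p u.2 then C (frameFunctional c vp u am)
    else ∑ i, if p u.2 ≤ i then C (frameFunctional c vp (i, u.2) am) * X (i, u.2) else 0
  let H : Matrix U U (MvPolynomial (Fin r × Fin n) k) :=
    Matrix.of fun u' u => (ε u').elim 0 fun am => ent u.1 am
  let b : U → MvPolynomial (Fin r × Fin n) k := Pi.single (ε.symm none) 1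
  let w := Matrix.cramer H b
  have hw : ∀ am, ∑ u : U, ent u.1 am * w u = 0 := by
    have hdet : H.det = 0 := Matrix.det_eq_zero_of_row_eq_zero (ε.symm none) fun u => by simp [H]
    have := Matrix.mulVec_cramer H b
    rw [hdet, zero_smul] at this
    intro am
    simpa [Matrix.mulVec, dotProduct, H] using congrFun this (ε.symm (some am))
  let W : Fin r × Fin n → MvPolynomial (Fin r × Fin n) k := fun u =>
    if h : (u.1 : ℕ) < (p u.2 : ℕ) + 1 then w ⟨u, h⟩ else 0
  let q : Fin n → U := fun j => ⟨(p j, j), Nat.lt_succ_self _⟩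
  let dF : Fin r × Fin n → (Fin r × Fin n →₀ ℕ) := fun u =>
    if u.1 < p u.2 then 0 else Finsupp.single (p u.2, u.2) 1
  let d : U → (Fin r × Fin n →₀ ℕ) := fun u => dF u.1
  have hent : ∀ u am, mo.degree (ent u am) ≼[mo] dF u := by
    intro u am
    by_cases hu : u.1 < p u.2
    · simp [ent, dF, hu, mo.degree_C]
    · simp only [ent, dF, hu, if_false]
      refine degree_sum_le_of_forall mo fun i _ => ?_
      split_ifs with hi
      · refine mo.degree_mul_le.trans ?_
        rw [mo.degree_C, zero_add]
        exact mo.degree_X_le_single.trans (hmo _ _ _ hi)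
      · simp
  have hupd : ∀ u₀ u' u : U,
      mo.degree (H.updateCol u₀ b u' u) ≼[mo] Function.update d u₀ 0 u := by
    intro u₀ u' u
    by_cases hu : u = u₀
    · subst hu
      simp only [Matrix.updateCol_self, Function.update_self, b, Pi.single_apply]
      split_ifs <;> simp
    · rw [Matrix.updateCol_ne hu, Function.update_of_ne hu]
      simp only [H, Matrix.of_apply]
      cases ε u' with
      | none => simp
      | some am => exact hent u.1 am
  have hwd : ∀ u₀ : U, mo.degree (w u₀) ≼[mo] ∑ u, Function.update d u₀ 0 u := by
    intro u₀
    simp only [w, Matrix.cramer_apply]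
    exact degree_det_le mo (hupd u₀)
  have hsum : ∀ u₀ : U, ∑ u, d u = ∑ u, Function.update d u₀ 0 u + d u₀ := by
    intro u₀
    rw [Finset.sum_update_of_mem (Finset.mem_univ u₀), zero_add, Finset.sdiff_singleton_eq_erase,
      Finset.sum_erase_add _ _ (Finset.mem_univ u₀)]
  have hdq : ∀ j, d (q j) = Finsupp.single (p j, j) 1 := fun j => by simp [d, dF, q]
  refine ⟨fun j => w (q j), fun u => if u.1 < p u.2 then W u else w (q u.2) * X u,
    fun j => ∑ u, Function.update d (q j) 0 u, fun i j hij => ?_, fun j => hwd _, fun j => ?_,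
    fun i j => ?_, fun am => ?_⟩
  · simp [not_lt.2 hij]
  · simp only [w, Matrix.cramer_apply]
    rw [coeff_det_of_degree_le mo (hupd (q j))]
    intro h0
    obtain ⟨τ, hτ, hz⟩ := Matrix.exists_mulVec_eq_zero_iff.2 h0
    have hcol : ∀ u', coeff 0 (b u') = if u' = ε.symm none then (1 : k) else 0 := by
      intro u'
      simp only [b, Pi.single_apply]
      split_ifs <;> simp
    have hcoe : ∀ (u : U) am, coeff (d u) (ent u.1 am) = frameFunctional c vp u.1 am := by
      rintro ⟨⟨i, l⟩, hu⟩ am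
      by_cases hi : i < p l
      · simp [d, dF, ent, hi]
      · obtain rfl : i = p l := le_antisymm (Fin.le_def.2 (Nat.lt_succ_iff.1 hu)) (not_lt.1 hi)
        simp only [d, dF, ent, hi, if_false, coeff_sum]
        rw [Finset.sum_eq_single (p l)]
        · simp [coeff_C_mul]
        · intro i _ hne
          split_ifs
          · rw [coeff_C_mul, coeff_X, if_neg, mul_zero]
            simpa [Finsupp.single_left_inj] using hne
          · simp
        · simp
    have hM : ∀ u' u, coeff (Function.update d (q j) 0 u) (H.updateCol (q j) b u' u) =
        if u = q j then (if u' = ε.symm none then 1 else 0)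
          else (ε u').elim 0 fun am => frameFunctional c vp u.1 am := by
      intro u' u
      split_ifs with hu h'
      · subst hu
        simp [hcol, h']
      · subst hu
        simp [hcol, h']
      · rw [Matrix.updateCol_ne hu, Function.update_of_ne hu]
        simp only [H, Matrix.of_apply]
        cases ε u' with
        | none => simp
        | some am => exact hcoe u am
    have hrow : ∀ u', ∑ u, (if u = q j then (if u' = ε.symm none then 1 else 0)
          else (ε u').elim 0 fun am => frameFunctional c vp u.1 am) * τ u = 0 := by
      intro u'
      have := congrFun hz u'
      simpa only [Matrix.mulVec, dotProduct, Matrix.of_apply, hM, Pi.zero_apply] using this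
    have hτq : τ (q j) = 0 := by
      have := hrow (ε.symm none)
      rw [Finset.sum_eq_single (q j) (fun u _ hu => by simp [hu]) (by simp)] at this
      simpa using this
    let T : Fin r × Fin n → k := fun u =>
      if h : (u.1 : ℕ) < (p u.2 : ℕ) + 1 then τ ⟨u, h⟩ else 0
    have hT := hc.eq_zero_of_sum_eq_zero
      (e := fun l => if l = j then (p l : ℕ) else (p l : ℕ) + 1)
      (fun l => by split_ifs <;> omega) (by
        have h1 : ∀ l, (if l = j then (p l : ℕ) else (p l : ℕ) + 1) + (if l = j then 1 else 0) =
            (p l : ℕ) + 1 := fun l => by split_ifs <;> rfl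
        have h2 := Finset.sum_congr (rfl : (Finset.univ : Finset (Fin n)) = _) fun l _ => h1 l
        rw [Finset.sum_add_distrib, Finset.sum_add_distrib] at h2
        simp at h2
        omega) T (by
        rintro ⟨i, l⟩ hu
        simp only [T]
        split_ifs with h
        · dsimp only at hu h
          split_ifs at hu with hl
          · subst hl
            have : i = p l := Fin.ext (by omega)
            subst this
            exact hτq
          · omega
        · rfl) (by
        intro am
        have h1 := hrow (ε.symm (some am))
        have h2 : ∀ u : U, (if u = q j then (if ε.symm (some am) = ε.symm none then 1 else 0)
            else (ε (ε.symm (some am))).elim 0 fun am => frameFunctional c vp u.1 am) * τ u =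
            T u.1 * frameFunctional c vp u.1 am := by
          intro u
          have hTu : T u.1 = τ u := dif_pos u.2
          rw [hTu]
          split_ifs with hu h3
          · simp at h3
          · rw [hu, hτq]; simp
          · rw [Equiv.apply_symm_apply]
            exact mul_comm _ _
        rw [Finset.sum_congr rfl fun u _ => h2 u] at h1
        rw [← h1, ← Finset.sum_subtype
          (Finset.univ.filter fun u : Fin r × Fin n => (u.1 : ℕ) < (p u.2 : ℕ) + 1)
          (by simp) fun u => T u * frameFunctional c vp u am]
        refine (Finset.sum_filter_of_ne fun u _ hu => ?_).symm
        by_contra hlt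
        exact hu (by rw [show T u = 0 from dif_neg hlt, zero_mul]))
    refine hτ (funext fun u => ?_)
    have := congrFun hT u.1
    rwa [show T u.1 = τ u from dif_pos u.2] at this
  · by_cases hi : i < p j
    · have hu : (i : ℕ) < (p j : ℕ) + 1 := (Fin.lt_def.1 hi).trans (Nat.lt_succ_self _)
      simp only [hi, if_true]
      have hWu : W (i, j) = w ⟨(i, j), hu⟩ := dif_pos hu
      rw [hWu]
      refine (hwd _).trans ?_
      have h1 := hsum ⟨(i, j), hu⟩
      have h2 : d ⟨(i, j), hu⟩ = 0 := by simp [d, dF, hi]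
      rw [h2, add_zero] at h1
      rw [← h1, hsum (q j), hdq, map_add, map_add]
      exact add_le_add le_rfl (hmo _ _ _ hi.le)
    · simp only [hi, if_false]
      refine mo.degree_mul_le.trans ?_
      rw [map_add, map_add]
      exact add_le_add (hwd _) mo.degree_X_le_single
  · rw [← hw am]
    have hWe : ∀ u : U, ent u.1 am * w u = ent u.1 am * W u.1 := by
      intro u
      rw [show W u.1 = w u from dif_pos u.2]
    rw [Finset.sum_congr rfl fun u _ => hWe u, ← Finset.sum_subtype
      (Finset.univ.filter fun u : Fin r × Fin n => (u.1 : ℕ) < (p u.2 : ℕ) + 1)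
      (by simp) fun u => ent u am * W u, Finset.sum_filter, Fintype.sum_prod_type_right,
      Fintype.sum_prod_type_right]
    refine Finset.sum_congr rfl fun j _ => ?_
    have hL : ∀ i : Fin r, (if i < p j then W (i, j) else w (q j) * X (i, j)) *
        C (frameFunctional c vp (i, j) am) =
        (if i < p j then C (frameFunctional c vp (i, j) am) * W (i, j) else 0) +
          w (q j) * if p j ≤ i then C (frameFunctional c vp (i, j) am) * X (i, j) else 0 := by
      intro i
      by_cases hi : i < p j
      · simp [hi, not_le.2 hi, mul_comm]
      · simp only [hi, if_false, not_lt.1 hi, if_true]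
        ring
    have hR : ∀ i : Fin r, (if (i : ℕ) < (p j : ℕ) + 1 then ent (i, j) am * W (i, j) else 0) =
        (if i < p j then C (frameFunctional c vp (i, j) am) * W (i, j) else 0) +
          if i = p j then w (q j) * ∑ i', (if p j ≤ i' then
            C (frameFunctional c vp (i', j) am) * X (i', j) else 0) else 0 := by
      intro i
      rcases lt_trichotomy i (p j) with hi | rfl | hi
      · rw [if_pos ((Fin.lt_def.1 hi).trans (Nat.lt_succ_self _)), if_pos hi, if_neg hi.ne]
        simp [ent, hi]
      · have hWu : W (p j, j) = w (q j) := dif_pos (Nat.lt_succ_self _)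
        simp [ent, hWu, mul_comm]
      · rw [if_neg (by have := Fin.lt_def.1 hi; omega), if_neg hi.not_gt, if_neg hi.ne']
        simp
    dsimp only
    rw [Finset.sum_congr rfl fun i _ => hL i, Finset.sum_congr rfl fun i _ => hR i,
      Finset.sum_add_distrib, Finset.sum_add_distrib, ← Finset.mul_sum]
    simp

end PolynomialPoint

section CellOrder

theorem exists_monomialOrder_cells (r n : ℕ) : ∃ mo : MonomialOrder.{0, 0} (Fin r × Fin n),
    (∀ a b : Fin r × Fin n →₀ ℕ, a ≼[mo] b → a.degree ≤ b.degree) ∧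
      ∀ (i i' : Fin r) (j : Fin n), i ≤ i' →
        Finsupp.single (i', j) 1 ≼[mo] Finsupp.single (i, j) 1 := by
  let ord : LinearOrder (Fin r × Fin n) :=
    LinearOrder.lift' (toLex : Fin r × Fin n → Fin r ×ₗ Fin n) toLex.injective
  have hwf : @WellFoundedGT (Fin r × Fin n) ord.toLT := @Finite.to_wellFoundedGT _ _ ord.toPreorder
  refine ⟨@degLex _ ord hwf, fun a b h => ?_, fun i i' j h => ?_⟩
  · exact @Finsupp.DegLex.monotone_degree _ ord _ _ h
  · rcases h.eq_or_lt with rfl | hlt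
    · exact le_rfl
    · exact le_of_lt ((@degLex_single_lt_iff _ ord hwf _ _).2 (Prod.Lex.left _ _ hlt))

end CellOrder

section KernelSplitting

variable {k : Type*} [Field k] {r n : ℕ} {v : Matrix (Fin r) (Fin n) k}
  {vp : Matrix (Fin 2) (Fin n) k}

theorem mul_transpose_eq_zero_of_span_eq_ker
    (hker : Submodule.span k (Set.range vp) = LinearMap.ker v.mulVecLin) : v * vp.transpose = 0 := by
  ext i m
  have h : vp m ∈ LinearMap.ker v.mulVecLin := hker ▸ Submodule.subset_span ⟨m, rfl⟩
  simpa [Matrix.mul_apply, Matrix.mulVec, dotProduct] using congrFun (LinearMap.mem_ker.1 h) i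

theorem minor_ne_zero_of_uniform (hn : n = r + 2)
    (huni : ∀ S : Finset (Fin n), S.card = r →
      LinearIndependent k (fun j : S => fun i => v i (j : Fin n)))
    (hind : LinearIndependent k (fun s : Fin 2 => vp s)) (hv : v * vp.transpose = 0)
    {l l' : Fin n} (hl : l ≠ l') : vp 0 l * vp 1 l' - vp 1 l * vp 0 l' ≠ 0 := by
  classical
  intro h0
  have hdet : (!![vp 0 l, vp 1 l; vp 0 l', vp 1 l'] : Matrix (Fin 2) (Fin 2) k).det = 0 := by
    rw [Matrix.det_fin_two_of, h0]
  obtain ⟨q, hq, hz⟩ := Matrix.exists_mulVec_eq_zero_iff.2 hdet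
  have hzl : ∑ s, q s * vp s l = 0 := by
    have := congrFun hz 0
    simpa [Matrix.mulVec, dotProduct, Fin.sum_univ_two, mul_comm] using this
  have hzl' : ∑ s, q s * vp s l' = 0 := by
    have := congrFun hz 1
    simpa [Matrix.mulVec, dotProduct, Fin.sum_univ_two, mul_comm] using this
  let y : Fin n → k := fun j => ∑ s, q s * vp s j
  let S : Finset (Fin n) := {l, l'}ᶜ
  have hS : S.card = r := by
    rw [Finset.card_compl, Finset.card_pair hl, Fintype.card_fin]
    omega
  have hyS : ∀ j, j ∉ S → y j = 0 := by
    intro j hj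
    have : j = l ∨ j = l' := by simpa [S, or_iff_not_imp_left] using hj
    rcases this with rfl | rfl
    · exact hzl
    · exact hzl'
  have hvy : ∑ j : S, y j • (fun i => v i (j : Fin n)) = 0 := by
    ext i
    have h1 : ∑ j, y j * v i j = 0 := by
      have h2 : ∀ s, ∑ j, v i j * vp s j = 0 := fun s => by
        simpa [Matrix.mul_apply] using congrFun (congrFun hv i) s
      simp only [y, Finset.sum_mul]
      rw [Finset.sum_comm]
      refine Finset.sum_eq_zero fun s _ => ?_
      rw [← mul_zero (q s), ← h2 s, Finset.mul_sum]
      exact Finset.sum_congr rfl fun j _ => by ring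
    simp only [Finset.sum_apply, Pi.smul_apply, smul_eq_mul, Pi.zero_apply]
    rw [Finset.sum_coe_sort S fun j => y j * v i j, ← h1]
    exact Finset.sum_subset (Finset.subset_univ S) fun j _ hj => by rw [hyS j hj, zero_mul]
  have hy : ∀ j, y j = 0 := by
    intro j
    by_cases hj : j ∈ S
    · exact Fintype.linearIndependent_iff.1 (huni S hS) (fun j => y j) hvy ⟨j, hj⟩
    · exact hyS j hj
  refine hq (funext fun s => Fintype.linearIndependent_iff.1 hind q ?_ s)
  ext j
  simpa [y] using hy j

theorem exists_splitting (hn : n = r + 2)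
    (hind : LinearIndependent k (fun s : Fin 2 => vp s))
    (hker : Submodule.span k (Set.range vp) = LinearMap.ker v.mulVecLin) :
    ∃ (A : Matrix (Fin n) (Fin r) k) (B : Matrix (Fin 2) (Fin n) k),
      A * v + vp.transpose * B = 1 := by
  have hfin : Module.finrank k (LinearMap.ker v.mulVecLin) = 2 := by
    rw [← hker]
    exact (finrank_span_eq_card hind).trans (Fintype.card_fin 2)
  have hsurj : Function.Surjective v.mulVec := by
    have h := LinearMap.finrank_range_add_finrank_ker v.mulVecLin
    rw [hfin, Module.finrank_fin_fun] at h
    have htop : LinearMap.range v.mulVecLin = ⊤ := by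
      refine Submodule.eq_top_of_finrank_eq ?_
      rw [Module.finrank_fin_fun]
      omega
    exact LinearMap.range_eq_top.1 htop
  obtain ⟨A, hA⟩ := Matrix.mulVec_surjective_iff_exists_right_inverse.1 hsurj
  have hmem : ∀ j, (fun i => (1 - A * v : Matrix (Fin n) (Fin n) k) i j) ∈
      Submodule.span k (Set.range vp) := by
    intro j
    rw [hker, LinearMap.mem_ker]
    have : v * (1 - A * v) = 0 := by
      rw [Matrix.mul_sub, Matrix.mul_one, ← Matrix.mul_assoc, hA, Matrix.one_mul, sub_self]
    ext i
    simpa [Matrix.mul_apply, Matrix.mulVec, dotProduct] using congrFun (congrFun this i) j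
  choose q hq using fun j => (Submodule.mem_span_range_iff_exists_fun k).1 (hmem j)
  refine ⟨A, Matrix.of fun s j => q j s, ?_⟩
  refine (sub_eq_iff_eq_add'.1 ?_).symm
  ext i j
  rw [← congrFun (hq j) i]
  simp [Matrix.mul_apply, mul_comm]

theorem exists_eq_mul_of_sum_eq_zero {S : Type*} [CommRing S] [Algebra k S]
    (hsplit : ∃ (A : Matrix (Fin n) (Fin r) k) (B : Matrix (Fin 2) (Fin n) k),
      A * v + vp.transpose * B = 1)
    (x : Fin r → Fin n → S) (hx : ∀ a m, ∑ j, x a j * algebraMap k S (vp m j) = 0) :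
    ∃ g : Fin r × Fin r → S, ∀ a j, x a j = ∑ b, g (a, b) * algebraMap k S (v b j) := by
  obtain ⟨A, B, h⟩ := hsplit
  let f := algebraMap k S
  have h' : A.map f * v.map f + vp.transpose.map f * B.map f = 1 := by
    rw [← Matrix.map_mul, ← Matrix.map_mul, ← Matrix.map_add _ f.map_add, h]
    exact Matrix.map_one _ f.map_zero f.map_one
  have hx' : (Matrix.of x) * vp.transpose.map f = 0 := by
    ext a m
    exact hx a m
  refine ⟨fun ab => ((Matrix.of x) * A.map f) ab.1 ab.2, fun a j => ?_⟩
  have := congrArg (fun N => Matrix.of x * N) h'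
  simp only [Matrix.mul_add, ← Matrix.mul_assoc, hx', Matrix.zero_mul, add_zero,
    Matrix.mul_one] at this
  exact (congrFun (congrFun this a) j).symm

end KernelSplitting

section OrbitIdeal

variable {k : Type*} [Field k] {r n : ℕ} (v : Matrix (Fin r) (Fin n) k)

/-- Pullback of functions along the parametrization `(g, s) ↦ g v diag(s)` of the orbit of `v`. -/
def orbitPullback : MvPolynomial (Fin r × Fin n) k →ₐ[k]
    MvPolynomial (Fin r × Fin r ⊕ Fin n) k :=
  aeval fun u => (∑ a, X (Sum.inl (u.1, a)) * C (v a u.2)) * X (Sum.inr u.2)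

theorem aeval_orbitPullback {S : Type*} [CommRing S] [Algebra k S] (g : Fin r × Fin r → S)
    (s : Fin n → S) (f : MvPolynomial (Fin r × Fin n) k) :
    aeval (Sum.elim g s) (orbitPullback v f) =
      aeval (fun u => (∑ a, g (u.1, a) * algebraMap k S (v a u.2)) * s u.2) f := by
  rw [orbitPullback, ← AlgHom.comp_apply, comp_aeval]
  congr 2
  ext u
  simp

theorem mem_vanIdeal {S : Set (Matrix (Fin r) (Fin n) k)} {f : MvPolynomial (Fin r × Fin n) k} :
    f ∈ vanIdeal k S ↔ ∀ w ∈ S, eval (fun ij => w ij.1 ij.2) f = 0 :=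
  Iff.rfl

theorem vanIdeal_matOrbit_eq_ker [Infinite k] :
    vanIdeal k (matOrbit k v) = RingHom.ker (orbitPullback v) := by
  classical
  ext f
  rw [RingHom.mem_ker, mem_vanIdeal]
  have hev : ∀ (g : Fin r × Fin r → k) (s : Fin n → k),
      eval (Sum.elim g s) (orbitPullback v f) =
        eval (fun u : Fin r × Fin n => (∑ a, g (u.1, a) * v a u.2) * s u.2) f := by
    intro g s
    have := aeval_orbitPullback v g s f
    simpa [coe_aeval_eq_eval] using this
  constructor
  · intro hf
    let δ : MvPolynomial (Fin r × Fin r ⊕ Fin n) k :=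
      (Matrix.of fun i a : Fin r => X (Sum.inl (i, a))).det
    have hδe : ∀ x : Fin r × Fin r ⊕ Fin n → k,
        eval x δ = (Matrix.of fun i a => x (Sum.inl (i, a))).det := by
      intro x
      simp only [δ, RingHom.map_det]
      congr 1
      ext i a
      simp
    have hδ : δ ≠ 0 := by
      intro h0
      have := hδe (Sum.elim (fun ia => (1 : Matrix (Fin r) (Fin r) k) ia.1 ia.2) 0)
      rw [h0, map_zero] at this
      have h1 : (Matrix.of fun i a : Fin r => (1 : Matrix (Fin r) (Fin r) k) i a) = 1 := rfl
      simp only [Sum.elim_inl, h1, Matrix.det_one] at this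
      exact zero_ne_one this
    have hσ : ∏ j : Fin n, (X (Sum.inr j) : MvPolynomial (Fin r × Fin r ⊕ Fin n) k) ≠ 0 :=
      Finset.prod_ne_zero_iff.2 fun j _ => X_ne_zero _
    have hprod : orbitPullback v f * δ * ∏ j : Fin n, X (Sum.inr j) = 0 := by
      refine MvPolynomial.funext fun x => ?_
      rw [map_zero, map_mul, map_mul, map_prod]
      by_cases hx1 : eval x δ = 0
      · rw [hx1, mul_zero, zero_mul]
      by_cases hx2 : ∀ j : Fin n, x (Sum.inr j) ≠ 0
      · suffices h : eval x (orbitPullback v f) = 0 by rw [h, zero_mul, zero_mul]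
        have hmem : (Matrix.of fun i j => (∑ a, x (Sum.inl (i, a)) * v a j) * x (Sum.inr j)) ∈
            matOrbit k v := by
          refine ⟨Matrix.nonsingInvUnit (Matrix.of fun i a => x (Sum.inl (i, a)))
            (isUnit_iff_ne_zero.2 (hδe x ▸ hx1)), fun j => (Units.mk0 _ (hx2 j))⁻¹, ?_⟩
          ext i j
          simp [Matrix.mul_apply, Matrix.nonsingInvUnit]
        have hx := hev (x ∘ Sum.inl) (x ∘ Sum.inr)
        rw [Sum.elim_comp_inl_inr] at hx
        have hw := hf _ hmem
        simp only [Matrix.of_apply] at hw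
        exact hx.trans hw
      · push Not at hx2
        obtain ⟨j, hj⟩ := hx2
        rw [Finset.prod_eq_zero (Finset.mem_univ j) (by simpa using hj), mul_zero]
    exact (mul_eq_zero.1 ((mul_eq_zero.1 hprod).resolve_right hσ)).resolve_right hδ
  · rintro hf w ⟨g, t, rfl⟩
    have := hev (fun ia => g.1 ia.1 ia.2) fun j => ((t j)⁻¹ : kˣ)
    rw [hf, map_zero] at this
    exact this.symm

theorem span_tensorMinors_le_vanIdeal {vp : Matrix (Fin 2) (Fin n) k} (hn : 0 < n)
    (hv : v * vp.transpose = 0) :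
    Ideal.span (tensorMinors r vp) ≤ vanIdeal k (matOrbit k v) := by
  rw [Ideal.span_le]
  rintro _ ⟨ρ, -, rfl⟩
  refine mem_vanIdeal.2 ?_
  rintro w ⟨g, t, rfl⟩
  rw [RingHom.map_det]
  refine Matrix.exists_mulVec_eq_zero_iff.1 ⟨fun j => (t j : k), fun h => ?_, ?_⟩
  · exact (t ⟨0, hn⟩).ne_zero (congrFun h ⟨0, hn⟩)
  · ext s
    have h : (g.1 * v * vp.transpose) (ρ s).1 (ρ s).2 = 0 := by
      rw [Matrix.mul_assoc, hv, Matrix.mul_zero, Matrix.zero_apply]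
    rw [Matrix.mul_apply] at h
    simp only [Matrix.mulVec, dotProduct, Pi.zero_apply]
    rw [← h]
    refine Finset.sum_congr rfl fun j _ => ?_
    have := (t j).ne_zero
    simp
    field_simp

end OrbitIdeal

section OrbitIdealEquality

variable {k : Type*} [Field k] {r n : ℕ}

theorem changeFrame_changeFrame {b c : Fin n → Matrix (Fin r) (Fin r) k}
    (h : ∀ j, b j * c j = 1) (f : MvPolynomial (Fin r × Fin n) k) :
    changeFrame b (changeFrame c f) = f := by
  suffices H : (changeFrame b).comp (changeFrame c) = AlgHom.id k _ from DFunLike.congr_fun H f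
  refine MvPolynomial.algHom_ext fun u => ?_
  obtain ⟨a, j⟩ := u
  have hC : ∀ x : k, changeFrame b (C x) = C x := fun x => (changeFrame b).commutes x
  have hX : ∀ (c : Fin n → Matrix (Fin r) (Fin r) k) u,
      changeFrame c (X u) = ∑ i, C (c u.2 i u.1) * X (i, u.2) := fun c u => aeval_X _ _
  have hbc : ∀ a', ∑ i, b j a' i * c j i a = if a' = a then 1 else 0 := fun a' => by
    rw [← Matrix.mul_apply, h j, Matrix.one_apply]
  simp only [AlgHom.comp_apply, AlgHom.id_apply, hX, map_sum, map_mul, hC, Finset.mul_sum]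
  rw [Finset.sum_comm]
  have : ∀ a', ∑ i, C (c j i a) * (C (b j a' i) * (X (a', j) : MvPolynomial (Fin r × Fin n) k)) =
      C (if a' = a then 1 else 0) * X (a', j) := fun a' => by
    rw [← hbc a', map_sum, Finset.sum_mul]
    exact Finset.sum_congr rfl fun i _ => by rw [C_mul]; ring
  rw [Finset.sum_congr rfl fun a' _ => this a']
  simp

theorem aeval_changeFrame_eq_zero {v : Matrix (Fin r) (Fin n) k} {vp : Matrix (Fin 2) (Fin n) k}
    {b c : Fin n → Matrix (Fin r) (Fin r) k} (h : ∀ j, c j * b j = 1)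
    (hsplit : ∃ (A : Matrix (Fin n) (Fin r) k) (B : Matrix (Fin 2) (Fin n) k),
      A * v + vp.transpose * B = 1)
    {S : Type*} [CommRing S] [Algebra k S] (z : Fin r × Fin n → S) (s : Fin n → S)
    (hz : ∀ am, ∑ u, z u * algebraMap k S (frameFunctional c vp u am) = 0)
    {F : MvPolynomial (Fin r × Fin n) k} (hF : orbitPullback v (changeFrame b F) = 0) :
    aeval (fun u => z u * s u.2) F = 0 := by
  obtain ⟨g, hg⟩ := exists_eq_mul_of_sum_eq_zero (S := S) hsplit
    (fun a j => ∑ i, z (i, j) * algebraMap k S (c j i a)) fun a m => by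
      rw [← hz (a, m), Fintype.sum_prod_type_right]
      refine Finset.sum_congr rfl fun j _ => ?_
      rw [Finset.sum_mul]
      refine Finset.sum_congr rfl fun i _ => ?_
      simp only [frameFunctional, map_mul]
      ring
  have h0 := aeval_orbitPullback v g s (changeFrame b F)
  rw [hF, map_zero, changeFrame, ← AlgHom.comp_apply, comp_aeval] at h0
  rw [h0]
  congr 2
  ext ⟨i, j⟩
  have hcb : ∀ i', ∑ a, c j i' a * b j a i = if i' = i then 1 else 0 := fun i' => by
    rw [← Matrix.mul_apply, h j, Matrix.one_apply]
  simp only [map_sum, map_mul, aeval_X, aeval_C, ← hg, Finset.sum_mul, Finset.mul_sum]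
  rw [Finset.sum_comm]
  have : ∀ i', ∑ a, algebraMap k S (b j a i) * (z (i', j) * algebraMap k S (c j i' a) * s j) =
      algebraMap k S (if i' = i then 1 else 0) * (z (i', j) * s j) := fun i' => by
    rw [← hcb i', map_sum, Finset.sum_mul]
    exact Finset.sum_congr rfl fun a _ => by rw [map_mul]; ring
  rw [Finset.sum_congr rfl fun i' _ => this i']
  simp

theorem span_tensorMinors_eq_vanIdeal [Infinite k] (hr : 1 ≤ r) (hn : n = r + 2)
    (v : Matrix (Fin r) (Fin n) k)
    (huni : ∀ S : Finset (Fin n), S.card = r →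
      LinearIndependent k (fun j : S => fun i => v i (j : Fin n)))
    (vp : Matrix (Fin 2) (Fin n) k)
    (hind : LinearIndependent k (fun s : Fin 2 => vp s))
    (hker : Submodule.span k (Set.range vp) = LinearMap.ker v.mulVecLin) :
    Ideal.span (tensorMinors r vp) = vanIdeal k (matOrbit k v) := by
  have hv := mul_transpose_eq_zero_of_span_eq_ker hker
  have hIP := span_tensorMinors_le_vanIdeal v (by omega) hv
  refine le_antisymm hIP fun f hf => ?_
  obtain ⟨c, hdet, hc⟩ := exists_isGenericFrame (r := r) fun l l' hl =>
    minor_ne_zero_of_uniform hn huni hind hv hl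
  obtain ⟨mo, hdeg, hmo⟩ := exists_monomialOrder_cells r n
  let b := fun j => (c j)⁻¹
  have hbc : ∀ j, b j * c j = 1 := fun j => Matrix.nonsing_inv_mul _ (isUnit_iff_ne_zero.2 (hdet j))
  have hcb : ∀ j, c j * b j = 1 := fun j => Matrix.mul_nonsing_inv _ (isUnit_iff_ne_zero.2 (hdet j))
  have hJ : ∀ K : Ideal (MvPolynomial (Fin r × Fin n) k), Ideal.span (tensorMinors r vp) ≤ K →
      (Ideal.span (tensorMinors r vp)).map (changeFrame c) ≤ K.comap (changeFrame b) := by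
    intro K hK
    rw [Ideal.map_le_iff_le_comap]
    intro p hp
    rw [Ideal.mem_comap, Ideal.mem_comap, changeFrame_changeFrame hbc]
    exact hK hp
  have hle := ideal_le_of_leading hr mo hdeg _ _ (hJ _ hIP)
    (exists_leading_minor hn hc mo hmo) fun p hp => by
      obtain ⟨lam, z, D, h1, h2, h3, h4, h5⟩ := exists_linear_relation hn hc mo hmo p hp
      refine ⟨lam, z, D, h1, h2, h3, h4, fun F hF => ?_⟩
      rw [Ideal.mem_comap, vanIdeal_matOrbit_eq_ker, RingHom.mem_ker] at hF
      exact aeval_changeFrame_eq_zero hcb (exists_splitting hn hind hker) z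
        (fun j => ∏ l ∈ Finset.univ.erase j, lam l) h5 hF
  have hf' : changeFrame c f ∈ (vanIdeal k (matOrbit k v)).comap (changeFrame b) := by
    rw [Ideal.mem_comap, changeFrame_changeFrame hbc]
    exact hf
  have := hJ _ le_rfl (hle hf')
  rwa [Ideal.mem_comap, changeFrame_changeFrame hbc] at this

end OrbitIdealEquality

/-- For `v ∈ k^{(n-2)×n}` with uniform matroid of rank `n-2`, the determinantal ideal
`I'_v` is prime and equals the vanishing ideal of the orbit of `v`. -/
theorem uniform_corank_two_ideal_prime
    {k : Type*} [Field k] [IsAlgClosed k] [CharZero k] {n : ℕ} (hn : 3 ≤ n)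
    (v : Matrix (Fin (n - 2)) (Fin n) k)
    (huni : ∀ S : Finset (Fin n), S.card = n - 2 →
      LinearIndependent k (fun j : S => fun i => v i (j : Fin n)))
    (vp : Matrix (Fin 2) (Fin n) k)
    (hind : LinearIndependent k (fun s : Fin 2 => vp s))
    (hker : Submodule.span k (Set.range vp) = LinearMap.ker v.mulVecLin) :
    (Ideal.span (minorSet5 k n vp)).IsPrime ∧
      Ideal.span (minorSet5 k n vp) = vanIdeal k (matOrbit k v) := by
  have := CharZero.infinite k
  have h : Ideal.span (minorSet5 k n vp) = vanIdeal k (matOrbit k v) :=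
    span_tensorMinors_eq_vanIdeal (by omega) (by omega) v huni vp hind hker
  refine ⟨?_, h⟩
  rw [h, vanIdeal_matOrbit_eq_ker]
  exact RingHom.ker_isPrime _
end
end

section
/- Let 0 ≤ r' ≤ r, let u ∈ k^{r×n₁} be a matrix whose rows r'+1,…,r are zero, and let v ∈ k^{r×n₂} be a matrix whose rows 1,…,r' are zero. Let (u,v) ∈ k^{r×(n₁+n₂)} denote the matrix obtained by concatenating the columns of u and v. Then the orbit closure of the concatenation is the product of the orbit closures: X_{(u,v)} = {(w₁,w₂) ∈ k^{r×(n₁+n₂)} : w₁ ∈ X_u and w₂ ∈ X_v}, where w₁ and w₂ denote the submatrices on the first n₁ and last n₂ columns. -/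
open MvPolynomial

noncomputable section

/-- The zero locus in matrix space of an ideal of `k[x_ij]`. -/
def zLocus {k : Type*} [Field k] {r n : ℕ} (I : Ideal (MvPolynomial (Fin r × Fin n) k)) :
    Set (Matrix (Fin r) (Fin n) k) :=
  {w | ∀ p ∈ I, eval (fun ij => w ij.1 ij.2) p = 0}

/-- The orbit closure `X_v` (zero locus of the vanishing ideal of the orbit). -/
def Xcl (k : Type*) [Field k] {r n : ℕ} (v : Matrix (Fin r) (Fin n) k) :
    Set (Matrix (Fin r) (Fin n) k) :=
  zLocus (vanIdeal k (matOrbit k v))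

/-- A polynomial identity in a point of the orbit extends to the orbit closure. -/
theorem eval_eq_zero_of_mem_Xcl {k : Type*} [Field k] {r n : ℕ} {σ : Type*}
    {v w : Matrix (Fin r) (Fin n) k} (hw : w ∈ Xcl k v)
    (Φ : σ → MvPolynomial (Fin r × Fin n) k) (p : MvPolynomial σ k)
    (h : ∀ a ∈ matOrbit k v, eval (fun s => eval (fun ij => a ij.1 ij.2) (Φ s)) p = 0) :
    eval (fun s => eval (fun ij => w ij.1 ij.2) (Φ s)) p = 0 := by
  have key : ∀ a : Matrix (Fin r) (Fin n) k, eval (fun ij => a ij.1 ij.2) (bind₁ Φ p) =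
      eval (fun s => eval (fun ij => a ij.1 ij.2) (Φ s)) p :=
    fun a => eval₂Hom_bind₁ _ _ _ _
  rw [← key]
  refine hw _ fun a ha => ?_
  rw [key]
  exact h a ha

/-- A polynomial that vanishes at all points of a line outside the zeros of a nonzero univariate
polynomial vanishes on the whole line. -/
theorem eval_eq_zero_of_line {k : Type*} [Field k] [Infinite k] {σ : Type*}
    (p : MvPolynomial σ k) (a b : σ → k) (d : Polynomial k) (hd : d ≠ 0)
    (h : ∀ s : k, d.eval s ≠ 0 → eval (fun i => a i + s * b i) p = 0) :
    eval a p = 0 := by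
  let q : Polynomial k :=
    aeval (fun i => Polynomial.C (a i) + Polynomial.X * Polynomial.C (b i)) p
  have key : ∀ s : k, q.eval s = eval (fun i => a i + s * b i) p := by
    intro s
    have : ((Polynomial.aeval s).comp (aeval (fun i =>
        Polynomial.C (a i) + Polynomial.X * Polynomial.C (b i))) : MvPolynomial σ k →ₐ[k] k) =
        aeval (fun i => a i + s * b i) := by
      ext i
      simp
      ring
    have := DFunLike.congr_fun this p
    rw [← Polynomial.coe_aeval_eq_eval, ← coe_aeval_eq_eval]
    exact this
  have hdq : d * q = 0 := by
    refine Polynomial.funext fun s => ?_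
    by_cases hs : d.eval s = 0
    · simp [hs]
    · simp [key, h s hs]
  have hq0 : q = 0 := (mul_eq_zero.mp hdq).resolve_left hd
  simpa [hq0] using (key 0).symm

/-- A polynomial vanishing on the orbit of `v` vanishes at `m v diag(t)⁻¹` for every square matrix
`m`, invertible or not. -/
theorem eval_mul_eq_zero_of_mem_vanIdeal {k : Type*} [Field k] [Infinite k] {r n : ℕ}
    {v : Matrix (Fin r) (Fin n) k} {p : MvPolynomial (Fin r × Fin n) k}
    (hp : p ∈ vanIdeal k (matOrbit k v)) (m : Matrix (Fin r) (Fin r) k) (t : Fin n → kˣ) :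
    eval (fun ij => (m * v) ij.1 ij.2 * ((t ij.2)⁻¹ : kˣ)) p = 0 := by
  refine eval_eq_zero_of_line p _ (fun ij => v ij.1 ij.2 * ((t ij.2)⁻¹ : kˣ)) (-m).charpoly
    (Matrix.charpoly_monic _).ne_zero fun s hs => ?_
  rw [Matrix.eval_charpoly, sub_neg_eq_add] at hs
  have hu : IsUnit (Matrix.scalar (Fin r) s + m) :=
    (Matrix.isUnit_iff_isUnit_det _).mpr (isUnit_iff_ne_zero.mpr hs)
  obtain ⟨g, hg⟩ := hu
  have h := hp _ ⟨g, t, rfl⟩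
  convert h using 3
  funext ij
  rw [hg]
  simp [Matrix.add_mul, ← Matrix.smul_eq_diagonal_mul]
  ring

/-- If the last `r − r'` rows of `u` vanish and the first `r'` rows of `v` vanish,
then the orbit closure of the column-concatenation `(u,v)` is the product of the orbit
closures `X_u × X_v`. -/
theorem orbit_closure_of_concatenation
    {k : Type*} [Field k] [IsAlgClosed k] [CharZero k] {r n₁ n₂ : ℕ}
    (r' : ℕ) (hr' : r' ≤ r)
    (u : Matrix (Fin r) (Fin n₁) k) (hu : ∀ i : Fin r, r' ≤ (i : ℕ) → ∀ j, u i j = 0)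
    (v : Matrix (Fin r) (Fin n₂) k) (hv : ∀ i : Fin r, (i : ℕ) < r' → ∀ j, v i j = 0) :
    Xcl k (Matrix.of fun i => Fin.append (u i) (v i)) =
      {w : Matrix (Fin r) (Fin (n₁ + n₂)) k |
        (Matrix.of fun i j => w i (Fin.castAdd n₂ j)) ∈ Xcl k u ∧
        (Matrix.of fun i j => w i (Fin.natAdd n₁ j)) ∈ Xcl k v} := by
  ext w
  constructor
  · intro hw
    constructor
    · intro p hp
      suffices h : _ from by
        simpa using eval_eq_zero_of_mem_Xcl hw (fun ij => X (ij.1, Fin.castAdd n₂ ij.2)) p h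
      rintro a ⟨g, t, rfl⟩
      convert hp _ ⟨g, fun j => t (Fin.castAdd n₂ j), rfl⟩ using 3
      simp [Matrix.mul_apply]
    · intro p hp
      suffices h : _ from by
        simpa using eval_eq_zero_of_mem_Xcl hw (fun ij => X (ij.1, Fin.natAdd n₁ ij.2)) p h
      rintro a ⟨g, t, rfl⟩
      convert hp _ ⟨g, fun j => t (Fin.natAdd n₁ j), rfl⟩ using 3
      simp [Matrix.mul_apply]
  · rintro ⟨hw₁, hw₂⟩ p hp
    have orbits : ∀ a ∈ matOrbit k u, ∀ b ∈ matOrbit k v,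
        eval (fun ij => Fin.append (a ij.1) (b ij.1) ij.2) p = 0 := by
      rintro _ ⟨g, t, rfl⟩ _ ⟨h, t', rfl⟩
      convert eval_mul_eq_zero_of_mem_vanIdeal hp
        (Matrix.of fun i l : Fin r => if (l : ℕ) < r' then g.1 i l else h.1 i l)
        (Fin.append t t') using 3
      funext ⟨i, j⟩
      refine Fin.addCases (fun j => ?_) (fun j => ?_) j
      · simp only [Matrix.of_apply, Fin.append_left, Matrix.mul_apply]
        congr 1
        refine Finset.sum_congr rfl fun l _ => ?_
        split_ifs with hl
        · rfl
        · simp [hu l (not_lt.mp hl)]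
      · simp only [Matrix.of_apply, Fin.append_right, Matrix.mul_apply]
        congr 1
        refine Finset.sum_congr rfl fun l _ => ?_
        split_ifs with hl
        · simp [hv l hl]
        · rfl
    have eval_append : ∀ {n : ℕ} (x : Fin r × Fin n → k)
        (f : Fin r → Fin n₁ → MvPolynomial (Fin r × Fin n) k)
        (g : Fin r → Fin n₂ → MvPolynomial (Fin r × Fin n) k) (ij : Fin r × Fin (n₁ + n₂)),
        eval x (Fin.append (f ij.1) (g ij.1) ij.2) =
          Fin.append (fun j => eval x (f ij.1 j)) (fun j => eval x (g ij.1 j)) ij.2 := by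
      rintro n x f g ⟨i, j⟩
      refine Fin.addCases (fun j => ?_) (fun j => ?_) j <;> simp
    have orbit_closure : ∀ a ∈ matOrbit k u,
        eval (fun ij => Fin.append (a ij.1) (fun j => w ij.1 (Fin.natAdd n₁ j)) ij.2) p = 0 := by
      intro a ha
      have h := eval_eq_zero_of_mem_Xcl hw₂
        (fun ij => Fin.append (fun j => C (a ij.1 j)) (fun j => X (ij.1, j)) ij.2) p
        fun b hb => by
          simp only [eval_append _ (fun i j => C (a i j)) (fun i j => X (i, j)), eval_C, eval_X]
          exact orbits a ha b hb
      simpa only [eval_append _ (fun i j => C (a i j)) (fun i j => X (i, j)), eval_C, eval_X,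
        Matrix.of_apply] using h
    have h := eval_eq_zero_of_mem_Xcl hw₁
      (fun ij => Fin.append (fun j => X (ij.1, j))
        (fun j => C (w ij.1 (Fin.natAdd n₁ j))) ij.2) p
      fun a ha => by
        simp only [eval_append _ (fun i j => X (i, j)) (fun i j => C (w i (Fin.natAdd n₁ j))),
          eval_C, eval_X]
        exact orbit_closure a ha
    simp only [eval_append _ (fun i j => X (i, j)) (fun i j => C (w i (Fin.natAdd n₁ j))),
      eval_C, eval_X] at h
    convert h using 3
    funext ⟨i, j⟩
    refine Fin.addCases (fun j => ?_) (fun j => ?_) j <;> simp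
end
end
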